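/- There exists a universal constant c > 0 with the following property. Let p ≥ 2 and n ≥ 1 be integers and ν > 0 a real number. For a unit vector ξ ∈ S^{p−1} ⊂ ℝ^p, let P_ξ denote the law of n i.i.d. samples X₁,…,X_n from the p-dimensional Gaussian distribution N_p(0, ν ξ ξᵀ + I_p). Then for every measurable estimator ξ̂ : (ℝ^p)^n → S^{p−1}, one has sup_{ξ ∈ S^{p−1}} E_{P_ξ}[ 1 − (ξ̂(X₁,…,X_n)ᵀ ξ)² ] ≥ c · min{ ((1+ν)/ν²) · (p/n), 1 }. In particular, inf_{ξ̂} sup_{ξ ∈ S^{p−1}} E[1 − (ξ̂ᵀ ξ)²] ≥ c · min{ ((1+ν)/ν²) (p/n), 1 }. -/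

import Mathlib

open Matrix MeasureTheory

/-- Euclidean norm of a real vector. -/
noncomputable def vecNorm {n : Type*} [Fintype n] (v : n → ℝ) : ℝ :=
  Real.sqrt (∑ i, v i ^ 2)

/-- The `p`-dimensional centered Gaussian measure `N_p(0, S)` on `Fin p → ℝ`,
defined by its density with respect to Lebesgue measure. -/
noncomputable def mvGaussian (p : ℕ) (S : Matrix (Fin p) (Fin p) ℝ) :
    Measure (Fin p → ℝ) :=
  volume.withDensity fun x =>
    ENNReal.ofReal (Real.sqrt (((2 * Real.pi) ^ p * S.det)⁻¹) *
      Real.exp (-(x ⬝ᵥ S⁻¹.mulVec x) / 2))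

section GaussianIntegral

variable {ι : Type*} [Fintype ι]

theorem hasIntegral_exp_neg_dotProduct_self :
    Integrable (fun x : ι → ℝ => Real.exp (-(x ⬝ᵥ x) / 2)) ∧
      ∫ x : ι → ℝ, Real.exp (-(x ⬝ᵥ x) / 2) = Real.sqrt ((2 * Real.pi) ^ Fintype.card ι) := by
  have hprod : (fun x : ι → ℝ => Real.exp (-(x ⬝ᵥ x) / 2)) =
      fun x => ∏ i, Real.exp (-(1 / 2) * x i ^ 2) := by
    funext x
    rw [← Real.exp_sum, ← Finset.mul_sum]
    congr 1
    simp only [dotProduct, pow_two]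
    ring
  rw [hprod]
  constructor
  · exact Integrable.fintype_prod (f := fun _ (t : ℝ) => Real.exp (-(1 / 2) * t ^ 2))
      fun _ => integrable_exp_neg_mul_sq (by norm_num)
  · rw [integral_fintype_prod_volume_eq_pow (fun t : ℝ => Real.exp (-(1 / 2) * t ^ 2)),
      integral_gaussian, Real.sqrt_eq_rpow, Real.sqrt_eq_rpow, ← Real.rpow_natCast,
      ← Real.rpow_natCast, ← Real.rpow_mul (by positivity), ← Real.rpow_mul (by positivity)]
    congr 1 <;> ring

variable [DecidableEq ι]

open scoped MatrixOrder in
/-- The Gaussian integral of a positive definite quadratic form. -/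
theorem hasIntegral_exp_neg_quadratic {A : Matrix ι ι ℝ} (hA : A.PosDef) :
    Integrable (fun x : ι → ℝ => Real.exp (-(x ⬝ᵥ A.mulVec x) / 2)) ∧
      ∫ x : ι → ℝ, Real.exp (-(x ⬝ᵥ A.mulVec x) / 2) =
        Real.sqrt ((2 * Real.pi) ^ Fintype.card ι / A.det) := by
  obtain ⟨B, hB⟩ := CStarAlgebra.nonneg_iff_eq_star_mul_self.1 hA.posSemidef.nonneg
  rw [Matrix.star_eq_conjTranspose] at hB
  have hdet : A.det = B.det ^ 2 := by
    rw [hB, Matrix.det_mul, Matrix.det_conjTranspose]; simp [pow_two]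
  have hBdet : B.det ≠ 0 := by
    intro h
    have := hA.det_pos
    rw [hdet, h] at this
    simp at this
  have hquad : (fun x : ι → ℝ => Real.exp (-(x ⬝ᵥ A.mulVec x) / 2)) =
      (fun y : ι → ℝ => Real.exp (-(y ⬝ᵥ y) / 2)) ∘ Matrix.toLin' B := by
    funext x
    simp only [Function.comp_apply, Matrix.toLin'_apply]
    rw [hB, ← Matrix.mulVec_mulVec, Matrix.dotProduct_mulVec,
      Matrix.conjTranspose_eq_transpose_of_trivial, Matrix.vecMul_transpose]
  have hmap := Real.map_matrix_volume_pi_eq_smul_volume_pi hBdet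
  have hmeas : AEMeasurable (Matrix.toLin' B) (volume : Measure (ι → ℝ)) :=
    (LinearMap.continuous_of_finiteDimensional _).measurable.aemeasurable
  have hint : Integrable (fun y : ι → ℝ => Real.exp (-(y ⬝ᵥ y) / 2))
      (Measure.map (Matrix.toLin' B) volume) := by
    rw [hmap]
    exact hasIntegral_exp_neg_dotProduct_self.1.smul_measure ENNReal.ofReal_ne_top
  rw [hquad]
  refine ⟨hint.comp_aemeasurable hmeas, ?_⟩
  rw [Function.comp_def, ← integral_map (f := fun y : ι → ℝ => Real.exp (-(y ⬝ᵥ y) / 2)) hmeas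
    hint.aestronglyMeasurable, hmap, integral_smul_measure,
    hasIntegral_exp_neg_dotProduct_self.2, ENNReal.toReal_ofReal (abs_nonneg _), hdet,
    Real.sqrt_div (by positivity), Real.sqrt_sq_eq_abs, abs_inv, smul_eq_mul]
  ring

end GaussianIntegral

section SpikedModel

variable {ι : Type*} [Fintype ι]

theorem dotProduct_sq_le (x y : ι → ℝ) : (x ⬝ᵥ y) ^ 2 ≤ (x ⬝ᵥ x) * (y ⬝ᵥ y) := by
  simpa only [dotProduct, ← pow_two] using Finset.sum_mul_sq_le_sq_mul_sq Finset.univ x y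

theorem vecNorm_eq_one_iff (v : ι → ℝ) : vecNorm v = 1 ↔ v ⬝ᵥ v = 1 := by
  simp only [vecNorm, Real.sqrt_eq_one, dotProduct, pow_two]

variable [DecidableEq ι]

/-- The average of the precision matrices of two spiked models with spikes `ξ` and `η`,
where `θ = ν / (1 + ν)`. -/
noncomputable def meanPrecision (θ : ℝ) (ξ η : ι → ℝ) : Matrix ι ι ℝ :=
  1 - (θ / 2) • (Matrix.vecMulVec ξ ξ + Matrix.vecMulVec η η)

theorem dotProduct_meanPrecision_mulVec (θ : ℝ) (ξ η x : ι → ℝ) :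
    x ⬝ᵥ (meanPrecision θ ξ η).mulVec x =
      x ⬝ᵥ x - θ / 2 * ((ξ ⬝ᵥ x) ^ 2 + (η ⬝ᵥ x) ^ 2) := by
  simp only [meanPrecision, Matrix.sub_mulVec, Matrix.smul_mulVec, Matrix.add_mulVec,
    Matrix.one_mulVec, dotProduct_sub, dotProduct_smul, dotProduct_add, smul_eq_mul,
    Matrix.vecMulVec_mulVec]
  simp only [op_smul_eq_smul, smul_eq_mul, dotProduct_comm x ξ,
    dotProduct_comm x η]
  ring

theorem posDef_meanPrecision {θ : ℝ} (h0 : 0 ≤ θ) (h1 : θ < 1) {ξ η : ι → ℝ}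
    (hξ : ξ ⬝ᵥ ξ = 1) (hη : η ⬝ᵥ η = 1) : (meanPrecision θ ξ η).PosDef := by
  refine Matrix.PosDef.of_dotProduct_mulVec_pos ?_ fun x hx => ?_
  · ext i j
    simp [meanPrecision, Matrix.vecMulVec_apply, Matrix.one_apply, eq_comm, mul_comm]
  · have hpos : 0 < x ⬝ᵥ x := by simpa using Matrix.dotProduct_star_self_pos_iff.2 hx
    have h₁ := dotProduct_sq_le ξ x
    have h₂ := dotProduct_sq_le η x
    rw [hξ, one_mul] at h₁
    rw [hη, one_mul] at h₂
    rw [star_trivial, dotProduct_meanPrecision_mulVec]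
    nlinarith

theorem det_meanPrecision (θ : ℝ) {ξ η : ι → ℝ} (hξ : ξ ⬝ᵥ ξ = 1) (hη : η ⬝ᵥ η = 1) :
    (meanPrecision θ ξ η).det = 1 - θ + θ ^ 2 / 4 * (1 - (ξ ⬝ᵥ η) ^ 2) := by
  let U : Matrix ι (Fin 2) ℝ := Matrix.of fun i k => θ / 2 * ![ξ i, η i] k
  let V : Matrix (Fin 2) ι ℝ := Matrix.of ![ξ, η]
  have hUV : meanPrecision θ ξ η = 1 - U * V := by
    ext i j
    simp [meanPrecision, U, V, Matrix.mul_apply, Matrix.vecMulVec_apply, Fin.sum_univ_two]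
    ring
  have hVU : V * U = Matrix.of ![![θ / 2, θ / 2 * (ξ ⬝ᵥ η)], ![θ / 2 * (ξ ⬝ᵥ η), θ / 2]] := by
    have hcol : ∀ a b : ι → ℝ, ∑ i, a i * (θ / 2 * b i) = θ / 2 * (a ⬝ᵥ b) := fun a b => by
      rw [dotProduct, Finset.mul_sum]
      exact Finset.sum_congr rfl fun i _ => by ring
    ext k l
    fin_cases k <;> fin_cases l <;>
      simp [U, V, Matrix.mul_apply, hcol, hξ, hη, dotProduct_comm η ξ]
  rw [hUV, Matrix.det_one_sub_mul_comm, hVU, Matrix.det_fin_two]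
  simp
  ring

theorem det_spikedCovariance (ν : ℝ) {ξ : ι → ℝ} (hξ : ξ ⬝ᵥ ξ = 1) :
    (ν • Matrix.vecMulVec ξ ξ + 1).det = 1 + ν := by
  rw [add_comm, ← Matrix.smul_vecMulVec, Matrix.vecMulVec_eq Unit,
    Matrix.det_one_add_replicateCol_mul_replicateRow, dotProduct_smul, hξ, smul_eq_mul, mul_one]

theorem inv_spikedCovariance {ν : ℝ} (hν : 0 < ν) {ξ : ι → ℝ} (hξ : ξ ⬝ᵥ ξ = 1) :
    (ν • Matrix.vecMulVec ξ ξ + 1)⁻¹ = meanPrecision (ν / (1 + ν)) ξ ξ := by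
  apply Matrix.inv_eq_right_inv
  have hsq : Matrix.vecMulVec ξ ξ * Matrix.vecMulVec ξ ξ = Matrix.vecMulVec ξ ξ := by
    rw [Matrix.vecMulVec_mul_vecMulVec, hξ, one_smul]
  have hν' : 1 + ν ≠ 0 := by positivity
  rw [meanPrecision, ← two_smul ℝ, smul_smul, mul_sub, mul_one, add_mul, one_mul, smul_mul_smul,
    hsq]
  ext i j
  simp
  field_simp
  ring

end SpikedModel

section Densities

variable {α : Type*} [MeasurableSpace α] {μ : Measure α}

theorem integral_withDensity_ofReal {f : α → ℝ} (hf : Measurable f) (hf0 : ∀ x, 0 ≤ f x)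
    (g : α → ℝ) :
    ∫ x, g x ∂(μ.withDensity fun x => ENNReal.ofReal (f x)) = ∫ x, f x * g x ∂μ := by
  rw [integral_withDensity_eq_integral_toReal_smul hf.ennreal_ofReal
    (Filter.Eventually.of_forall fun _ => ENNReal.ofReal_lt_top)]
  simp only [ENNReal.toReal_ofReal (hf0 _), smul_eq_mul]

theorem isProbabilityMeasure_withDensity_ofReal {f : α → ℝ} (hf0 : ∀ x, 0 ≤ f x)
    (hf : Integrable f μ) (hf1 : ∫ x, f x ∂μ = 1) :
    IsProbabilityMeasure (μ.withDensity fun x => ENNReal.ofReal (f x)) := by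
  constructor
  rw [withDensity_apply _ MeasurableSet.univ, Measure.restrict_univ,
    ← ofReal_integral_eq_lintegral_ofReal hf (Filter.Eventually.of_forall hf0), hf1,
    ENNReal.ofReal_one]

/-- A product of copies of a measure with a density has the product density. -/
theorem pi_withDensity_ofReal {ι : Type*} [Fintype ι] [SigmaFinite μ] {f : α → ℝ}
    (hf0 : ∀ x, 0 ≤ f x) (hf : Integrable f μ) :
    Measure.pi (fun _ : ι => μ.withDensity fun x => ENNReal.ofReal (f x)) =
      (Measure.pi fun _ : ι => μ).withDensity fun x => ENNReal.ofReal (∏ i, f (x i)) := by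
  have : IsFiniteMeasure (μ.withDensity fun x => ENNReal.ofReal (f x)) :=
    isFiniteMeasure_withDensity_ofReal hf.2
  refine Measure.pi_eq fun s hs => ?_
  have hres : ∀ i, Integrable f (μ.restrict (s i)) := fun i => hf.restrict
  rw [withDensity_apply _ (MeasurableSet.univ_pi hs), Measure.restrict_pi_pi,
    ← ofReal_integral_eq_lintegral_ofReal (Integrable.fintype_prod (f := fun _ => f) hres)
      (Filter.Eventually.of_forall fun x => Finset.prod_nonneg fun i _ => hf0 _),
    integral_fintype_prod_eq_prod (fun _ => f),
    ENNReal.ofReal_prod_of_nonneg fun i _ => integral_nonneg hf0]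
  refine Finset.prod_congr rfl fun i _ => ?_
  rw [withDensity_apply _ (hs i),
    ofReal_integral_eq_lintegral_ofReal (hres i) (Filter.Eventually.of_forall hf0)]

theorem two_point_pointwise {f g h a t : ℝ} (hf : 0 ≤ f) (hg : 0 ≤ g) (hfg : h ^ 2 = f * g) :
    2 * t ^ 2 * h - t ^ 2 / 2 * (f + g) ≤ f * (a - t) ^ 2 + g * (a + t) ^ 2 := by
  have ht := sq_nonneg t
  have ha : 2 * t ^ 2 ≤ (a - t) ^ 2 + (a + t) ^ 2 := by nlinarith [sq_nonneg a]
  rcases le_total f g with hle | hle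
  · have hh : h ≤ f + g / 4 := abs_le_of_sq_le_sq' (by nlinarith [sq_nonneg (f - g / 4)])
      (by positivity) |>.2
    nlinarith [mul_le_mul_of_nonneg_left ha hf, mul_le_mul_of_nonneg_left hh ht,
      mul_nonneg (sub_nonneg.2 hle) (sq_nonneg (a + t)), mul_nonneg ht hf]
  · have hh : h ≤ g + f / 4 := abs_le_of_sq_le_sq' (by nlinarith [sq_nonneg (g - f / 4)])
      (by positivity) |>.2
    nlinarith [mul_le_mul_of_nonneg_left ha hg, mul_le_mul_of_nonneg_left hh ht,
      mul_nonneg (sub_nonneg.2 hle) (sq_nonneg (a - t)), mul_nonneg ht hg]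

theorem integrable_mul_sub_sq {f a : α → ℝ} (hf : Integrable f μ) (ha : Measurable a)
    (ha1 : ∀ x, |a x| ≤ 1) (t : ℝ) : Integrable (fun x => f x * (a x - t) ^ 2) μ := by
  refine hf.mul_bdd (c := (1 + |t|) ^ 2) ((ha.sub_const t).pow_const 2).aestronglyMeasurable
    (Filter.Eventually.of_forall fun x => ?_)
  rw [Real.norm_eq_abs, abs_pow]
  exact pow_le_pow_left₀ (abs_nonneg _) ((abs_sub _ _).trans (by linarith [ha1 x])) 2

/-- The two-point lower bound in terms of the Hellinger affinity `∫ h` of the probability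
densities `f` and `g`. -/
theorem two_point_lower_bound {f g h a : α → ℝ} (hf0 : ∀ x, 0 ≤ f x) (hg0 : ∀ x, 0 ≤ g x)
    (hfg : ∀ x, h x ^ 2 = f x * g x) (hf : Integrable f μ) (hg : Integrable g μ)
    (hh : Integrable h μ) (hf1 : ∫ x, f x ∂μ = 1) (hg1 : ∫ x, g x ∂μ = 1)
    (ha : Measurable a) (ha1 : ∀ x, |a x| ≤ 1) (t : ℝ) :
    2 * t ^ 2 * ∫ x, h x ∂μ - t ^ 2 ≤
      ∫ x, f x * (a x - t) ^ 2 ∂μ + ∫ x, g x * (a x - -t) ^ 2 ∂μ := by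
  have hif := integrable_mul_sub_sq hf ha ha1 t
  have hig := integrable_mul_sub_sq hg ha ha1 (-t)
  have hsum : Integrable (fun x => f x + g x) μ := hf.add hg
  calc 2 * t ^ 2 * ∫ x, h x ∂μ - t ^ 2
      = ∫ x, (2 * t ^ 2 * h x - t ^ 2 / 2 * (f x + g x)) ∂μ := by
        rw [integral_sub (hh.const_mul _) (hsum.const_mul _), integral_const_mul,
          integral_const_mul, integral_add hf hg, hf1, hg1]
        ring
    _ ≤ ∫ x, (f x * (a x - t) ^ 2 + g x * (a x - -t) ^ 2) ∂μ := by
        refine integral_mono ((hh.const_mul _).sub (hsum.const_mul _)) (hif.add hig)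
          fun x => ?_
        simpa only [sub_neg_eq_add] using two_point_pointwise (hf0 x) (hg0 x) (hfg x)
    _ = _ := integral_add hif hig

end Densities

section SpikedDensity

variable {ι : Type*} [Fintype ι] [DecidableEq ι]

/-- The geometric mean of the densities of the Gaussian laws with covariance matrices
`ν ξ ξᵀ + 1` and `ν η ηᵀ + 1`. -/
noncomputable def pairDensity (ν : ℝ) (ξ η x : ι → ℝ) : ℝ :=
  Real.sqrt (((2 * Real.pi) ^ Fintype.card ι * (1 + ν))⁻¹) *
    Real.exp (-(x ⬝ᵥ (meanPrecision (ν / (1 + ν)) ξ η).mulVec x) / 2)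

theorem pairDensity_nonneg (ν : ℝ) (ξ η x : ι → ℝ) : 0 ≤ pairDensity ν ξ η x := by
  unfold pairDensity; positivity

theorem pairDensity_sq (ν : ℝ) (ξ η x : ι → ℝ) :
    pairDensity ν ξ η x ^ 2 = pairDensity ν ξ ξ x * pairDensity ν η η x := by
  simp only [pairDensity, dotProduct_meanPrecision_mulVec]
  rw [mul_pow, ← Real.exp_nat_mul, mul_mul_mul_comm, ← Real.exp_add, ← pow_two]
  congr 2
  push_cast
  ring

theorem measurable_pairDensity (ν : ℝ) (ξ η : ι → ℝ) : Measurable (pairDensity ν ξ η) := by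
  have : Continuous (pairDensity ν ξ η) := by
    unfold pairDensity
    simp only [dotProduct_meanPrecision_mulVec]
    simp only [dotProduct]
    fun_prop
  exact this.measurable

theorem mvGaussian_spiked {p : ℕ} {ν : ℝ} (hν : 0 < ν) {ξ : Fin p → ℝ} (hξ : ξ ⬝ᵥ ξ = 1) :
    mvGaussian p (ν • Matrix.vecMulVec ξ ξ + 1) =
      volume.withDensity fun x => ENNReal.ofReal (pairDensity ν ξ ξ x) := by
  simp only [mvGaussian, pairDensity, inv_spikedCovariance hν hξ, det_spikedCovariance ν hξ,
    Fintype.card_fin]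

theorem hasIntegral_pairDensity {ν : ℝ} (hν : 0 < ν) {ξ η : ι → ℝ} (hξ : ξ ⬝ᵥ ξ = 1)
    (hη : η ⬝ᵥ η = 1) :
    Integrable (pairDensity ν ξ η) ∧
      ∫ x, pairDensity ν ξ η x =
        (Real.sqrt (1 + ν ^ 2 * (1 - (ξ ⬝ᵥ η) ^ 2) / (4 * (1 + ν))))⁻¹ := by
  have hθ : ν / (1 + ν) < 1 := by rw [div_lt_one (by positivity)]; linarith
  have hG := hasIntegral_exp_neg_quadratic
    (posDef_meanPrecision (by positivity : 0 ≤ ν / (1 + ν)) hθ hξ hη)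
  refine ⟨hG.1.const_mul _, ?_⟩
  simp only [pairDensity]
  rw [integral_const_mul, hG.2, ← Real.sqrt_mul (by positivity), ← Real.sqrt_inv,
    det_meanPrecision _ hξ hη]
  congr 1
  have hdet : (1 + ν) * (1 - ν / (1 + ν) + (ν / (1 + ν)) ^ 2 / 4 * (1 - (ξ ⬝ᵥ η) ^ 2)) =
      1 + ν ^ 2 * (1 - (ξ ⬝ᵥ η) ^ 2) / (4 * (1 + ν)) := by
    field_simp
    ring
  rw [← hdet, mul_inv, mul_inv]
  field_simp

theorem one_sub_le_integral_pairDensity {ν : ℝ} (hν : 0 < ν) {ξ η : ι → ℝ} (hξ : ξ ⬝ᵥ ξ = 1)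
    (hη : η ⬝ᵥ η = 1) :
    1 - ν ^ 2 * (1 - (ξ ⬝ᵥ η) ^ 2) / (4 * (1 + ν)) / 2 ≤ ∫ x, pairDensity ν ξ η x := by
  rw [(hasIntegral_pairDensity hν hξ hη).2]
  have hτ : 0 ≤ ν ^ 2 * (1 - (ξ ⬝ᵥ η) ^ 2) / (4 * (1 + ν)) := by
    have := dotProduct_sq_le ξ η
    rw [hξ, hη, one_mul] at this
    have := sub_nonneg.2 this
    positivity
  set τ := ν ^ 2 * (1 - (ξ ⬝ᵥ η) ^ 2) / (4 * (1 + ν))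
  have hs : Real.sqrt (1 + τ) ≤ 1 + τ / 2 := by
    rw [Real.sqrt_le_left (by positivity)]
    nlinarith [sq_nonneg τ]
  have hs0 : 0 < Real.sqrt (1 + τ) := Real.sqrt_pos.2 (by positivity)
  rw [← one_div, le_div_iff₀ hs0]
  rcases le_total (1 - τ / 2) 0 with hneg | hpos
  · nlinarith
  · nlinarith [mul_le_mul_of_nonneg_left hs hpos, sq_nonneg τ]

end SpikedDensity

section SampleDensity

variable {ι κ : Type*} [Fintype ι] [DecidableEq ι] [Fintype κ]

/-- The geometric mean of the joint densities of i.i.d. samples, indexed by `κ`, from the two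
spiked models with spikes `ξ` and `η`. -/
noncomputable def samplePairDensity (ν : ℝ) (ξ η : ι → ℝ) (x : κ → ι → ℝ) : ℝ :=
  ∏ j, pairDensity ν ξ η (x j)

theorem samplePairDensity_nonneg (ν : ℝ) (ξ η : ι → ℝ) (x : κ → ι → ℝ) :
    0 ≤ samplePairDensity ν ξ η x :=
  Finset.prod_nonneg fun _ _ => pairDensity_nonneg _ _ _ _

theorem samplePairDensity_sq (ν : ℝ) (ξ η : ι → ℝ) (x : κ → ι → ℝ) :
    samplePairDensity ν ξ η x ^ 2 =
      samplePairDensity ν ξ ξ x * samplePairDensity ν η η x := by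
  simp only [samplePairDensity, ← Finset.prod_pow, pairDensity_sq, Finset.prod_mul_distrib]

theorem measurable_samplePairDensity (ν : ℝ) (ξ η : ι → ℝ) :
    Measurable (samplePairDensity ν ξ η : (κ → ι → ℝ) → ℝ) :=
  Finset.measurable_fun_prod _ fun j _ =>
    (measurable_pairDensity ν ξ η).comp (measurable_pi_apply j)

theorem integrable_samplePairDensity {ν : ℝ} (hν : 0 < ν) {ξ η : ι → ℝ} (hξ : ξ ⬝ᵥ ξ = 1)
    (hη : η ⬝ᵥ η = 1) : Integrable (samplePairDensity ν ξ η : (κ → ι → ℝ) → ℝ) :=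
  Integrable.fintype_prod (f := fun _ : κ => pairDensity ν ξ η)
    fun _ => (hasIntegral_pairDensity hν hξ hη).1

theorem integral_samplePairDensity (ν : ℝ) (ξ η : ι → ℝ) :
    ∫ x : κ → ι → ℝ, samplePairDensity ν ξ η x =
      (∫ x, pairDensity ν ξ η x) ^ Fintype.card κ :=
  integral_fintype_prod_volume_eq_pow (pairDensity ν ξ η)

theorem integral_samplePairDensity_self {ν : ℝ} (hν : 0 < ν) {ξ : ι → ℝ} (hξ : ξ ⬝ᵥ ξ = 1) :
    ∫ x : κ → ι → ℝ, samplePairDensity ν ξ ξ x = 1 := by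
  rw [integral_samplePairDensity, (hasIntegral_pairDensity hν hξ hξ).2, hξ]
  simp

theorem three_quarters_le_integral_samplePairDensity [Nonempty κ] {ν : ℝ} (hν : 0 < ν)
    {ξ η : ι → ℝ} (hξ : ξ ⬝ᵥ ξ = 1) (hη : η ⬝ᵥ η = 1)
    (hsep : Fintype.card κ * (ν ^ 2 * (1 - (ξ ⬝ᵥ η) ^ 2) / (4 * (1 + ν))) ≤ 1 / 2) :
    3 / 4 ≤ ∫ x : κ → ι → ℝ, samplePairDensity ν ξ η x := by
  rw [integral_samplePairDensity]
  have hτ : 0 ≤ ν ^ 2 * (1 - (ξ ⬝ᵥ η) ^ 2) / (4 * (1 + ν)) := by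
    have := dotProduct_sq_le ξ η
    rw [hξ, hη, one_mul] at this
    have := sub_nonneg.2 this
    positivity
  have hle := one_sub_le_integral_pairDensity hν hξ hη
  set τ := ν ^ 2 * (1 - (ξ ⬝ᵥ η) ^ 2) / (4 * (1 + ν))
  have hcard : (1 : ℝ) ≤ Fintype.card κ := by exact_mod_cast Fintype.card_pos
  have hτ1 : τ ≤ 1 / 2 := by nlinarith
  have hbern := one_add_mul_le_pow (a := -(τ / 2)) (by linarith) (Fintype.card κ)
  calc (3 / 4 : ℝ) ≤ 1 + Fintype.card κ * -(τ / 2) := by linarith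
    _ ≤ (1 + -(τ / 2)) ^ Fintype.card κ := hbern
    _ ≤ _ := pow_le_pow_left₀ (by linarith) (by linarith) _

theorem pi_mvGaussian_spiked {p : ℕ} {ν : ℝ} (hν : 0 < ν) {ξ : Fin p → ℝ} (hξ : ξ ⬝ᵥ ξ = 1) :
    Measure.pi (fun _ : κ => mvGaussian p (ν • Matrix.vecMulVec ξ ξ + 1)) =
      volume.withDensity fun x => ENNReal.ofReal (samplePairDensity ν ξ ξ x) := by
  simp only [mvGaussian_spiked hν hξ]
  exact pi_withDensity_ofReal (pairDensity_nonneg ν ξ ξ) (hasIntegral_pairDensity hν hξ hξ).1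

end SampleDensity

section Hypercube

variable {d : ℕ}

/-- The unit vectors `(c, ± s, …, ± s)` indexed by sign patterns. -/
noncomputable def cubeSpike (c s : ℝ) (ω : Fin d → Bool) : Fin (d + 1) → ℝ :=
  Fin.cons c fun i => s * if ω i then 1 else -1

/-- The sign pattern `ω` with its `i`-th sign reversed. -/
def flipSign (i : Fin d) (ω : Fin d → Bool) : Fin d → Bool :=
  Function.update ω i (!ω i)

theorem flipSign_involutive (i : Fin d) : Function.Involutive (flipSign i) := fun ω => by
  simp [flipSign]

theorem cubeSpike_flipSign (c s : ℝ) (i : Fin d) (ω : Fin d → Bool) :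
    cubeSpike c s (flipSign i ω) i.succ = -cubeSpike c s ω i.succ := by
  cases h : ω i <;> simp [cubeSpike, flipSign, h]

theorem cubeSpike_succ_sq (c s : ℝ) (i : Fin d) (ω : Fin d → Bool) :
    cubeSpike c s ω i.succ ^ 2 = s ^ 2 := by
  cases h : ω i <;> simp [cubeSpike, h]

theorem cubeSpike_dotProduct_self {c s : ℝ} (hcs : c ^ 2 + d * s ^ 2 = 1) (ω : Fin d → Bool) :
    cubeSpike c s ω ⬝ᵥ cubeSpike c s ω = 1 := by
  simp only [dotProduct, ← pow_two, Fin.sum_univ_succ, cubeSpike_succ_sq]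
  simpa [cubeSpike] using hcs

theorem cubeSpike_dotProduct_flipSign {c s : ℝ} (hcs : c ^ 2 + d * s ^ 2 = 1) (i : Fin d)
    (ω : Fin d → Bool) :
    cubeSpike c s ω ⬝ᵥ cubeSpike c s (flipSign i ω) = 1 - 2 * s ^ 2 := by
  have hterm : ∀ j : Fin d, cubeSpike c s ω j.succ * cubeSpike c s (flipSign i ω) j.succ =
      s ^ 2 - if j = i then 2 * s ^ 2 else 0 := by
    intro j
    split_ifs with hj
    · subst hj
      rw [cubeSpike_flipSign, mul_neg, ← pow_two, cubeSpike_succ_sq]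
      ring
    · have : cubeSpike c s (flipSign i ω) j.succ = cubeSpike c s ω j.succ := by
        simp [cubeSpike, flipSign, hj]
      rw [this, ← pow_two, cubeSpike_succ_sq, sub_zero]
  simp only [dotProduct, Fin.sum_univ_succ, hterm, Finset.sum_sub_distrib]
  simp [cubeSpike]
  linarith

/-- Averaging over the hypercube: pairwise lower bounds along each coordinate direction add up to
a lower bound for the maximum. -/
theorem assouad_average {H : Fin d → (Fin d → Bool) → ℝ} {b R : ℝ}
    (hb : ∀ i ω, b ≤ H i ω + H i (flipSign i ω)) (hR : ∀ ω, ∑ i, H i ω ≤ R) :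
    d * b / 2 ≤ R := by
  have hflip : ∀ i, ∑ ω, H i (flipSign i ω) = ∑ ω, H i ω := fun i =>
    Equiv.sum_comp (flipSign_involutive i).toPerm (H i)
  have hupper : ∑ ω : Fin d → Bool, ∑ i, H i ω ≤ 2 ^ d * R := by
    calc ∑ ω : Fin d → Bool, ∑ i, H i ω ≤ ∑ _ω : Fin d → Bool, R :=
          Finset.sum_le_sum fun ω _ => hR ω
      _ = 2 ^ d * R := by simp
  have hlower : 2 ^ d * (d * b) ≤ 2 * ∑ ω : Fin d → Bool, ∑ i, H i ω := by
    calc (2 ^ d * (d * b) : ℝ) = ∑ _i : Fin d, ∑ _ω : Fin d → Bool, b := by simp; ring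
      _ ≤ ∑ i, ∑ ω, (H i ω + H i (flipSign i ω)) :=
          Finset.sum_le_sum fun i _ => Finset.sum_le_sum fun ω _ => hb i ω
      _ = 2 * ∑ ω : Fin d → Bool, ∑ i, H i ω := by
          simp only [Finset.sum_add_distrib, hflip]
          rw [Finset.sum_comm, two_mul]
  have h2 : (0 : ℝ) < 2 ^ d := by positivity
  have : (2 : ℝ) ^ d * (d * b / 2) ≤ 2 ^ d * R := by linarith
  exact le_of_mul_le_mul_left this h2

end Hypercube

section Loss

/-- The squared distance between the entries of `e eᵀ` and `ξ ξᵀ` in the first row, off the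
diagonal, is at most `1 - (eᵀ ξ)²`. -/
theorem sum_offDiag_sq_le {d : ℕ} {e ξ : Fin (d + 1) → ℝ} (he : e ⬝ᵥ e = 1) (hξ : ξ ⬝ᵥ ξ = 1) :
    ∑ i : Fin d, (e 0 * e i.succ - ξ 0 * ξ i.succ) ^ 2 ≤ 1 - (e ⬝ᵥ ξ) ^ 2 := by
  have hcs := dotProduct_sq_le (fun i : Fin d => e i.succ) (fun i => ξ i.succ)
  have hexp : ∑ i : Fin d, (e 0 * e i.succ - ξ 0 * ξ i.succ) ^ 2 =
      e 0 ^ 2 * ∑ i : Fin d, e i.succ * e i.succ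
        - 2 * (e 0 * ξ 0) * ∑ i : Fin d, e i.succ * ξ i.succ
        + ξ 0 ^ 2 * ∑ i : Fin d, ξ i.succ * ξ i.succ := by
    simp only [Finset.mul_sum, ← Finset.sum_sub_distrib, ← Finset.sum_add_distrib]
    exact Finset.sum_congr rfl fun i _ => by ring
  simp only [dotProduct, Fin.sum_univ_succ] at he hξ hcs ⊢
  rw [hexp]
  set x := ∑ i : Fin d, e i.succ * e i.succ
  set y := ∑ i : Fin d, ξ i.succ * ξ i.succ
  set z := ∑ i : Fin d, e i.succ * ξ i.succ
  have hx : x = 1 - e 0 * e 0 := by linarith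
  have hy : y = 1 - ξ 0 * ξ 0 := by linarith
  rw [hx, hy] at hcs ⊢
  nlinarith [sq_nonneg (e 0 ^ 2 - ξ 0 ^ 2)]

theorem abs_mul_le_one_of_dotProduct_self {ι : Type*} [Fintype ι] {e : ι → ℝ} (he : e ⬝ᵥ e = 1)
    (i j : ι) : |e i * e j| ≤ 1 := by
  have hcoord : ∀ k, |e k| ≤ 1 := fun k => by
    rw [← sq_le_one_iff_abs_le_one, ← he, pow_two]
    exact Finset.single_le_sum (f := fun k => e k * e k) (fun k _ => mul_self_nonneg _)
      (Finset.mem_univ k)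
  rw [abs_mul]
  exact mul_le_one₀ (hcoord i) (abs_nonneg _) (hcoord j)

end Loss

section Risk

variable {p : ℕ} {κ : Type*} [Fintype κ] {ν : ℝ} {est : (κ → Fin p → ℝ) → Fin p → ℝ}

theorem bddAbove_risk (hν : 0 < ν) (hunit : ∀ x, est x ⬝ᵥ est x = 1) :
    BddAbove (Set.range fun ξ : {v : Fin p → ℝ // vecNorm v = 1} =>
      ∫ x, (1 - (est x ⬝ᵥ ξ.1) ^ 2)
        ∂(Measure.pi fun _ : κ => mvGaussian p (ν • Matrix.vecMulVec ξ.1 ξ.1 + 1))) := by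
  refine ⟨1, ?_⟩
  rintro _ ⟨⟨ξ, hξ⟩, rfl⟩
  rw [vecNorm_eq_one_iff] at hξ
  have hprob : IsProbabilityMeasure
      (Measure.pi fun _ : κ => mvGaussian p (ν • Matrix.vecMulVec ξ ξ + 1)) := by
    rw [pi_mvGaussian_spiked hν hξ]
    exact isProbabilityMeasure_withDensity_ofReal (samplePairDensity_nonneg ν ξ ξ)
      (integrable_samplePairDensity hν hξ hξ) (integral_samplePairDensity_self hν hξ)
  calc _ ≤ ∫ _, (1 : ℝ) ∂(Measure.pi fun _ : κ =>
        mvGaussian p (ν • Matrix.vecMulVec ξ ξ + 1)) := by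
        refine integral_mono_of_nonneg (Filter.Eventually.of_forall fun x => ?_)
          (integrable_const _) (Filter.Eventually.of_forall fun x => ?_)
        · have := dotProduct_sq_le (est x) ξ
          rw [hunit, hξ, one_mul] at this
          exact sub_nonneg.2 this
        · exact sub_le_self _ (sq_nonneg _)
    _ = 1 := by simp

theorem sum_integral_offDiag_le_risk {d : ℕ} {est : (κ → Fin (d + 1) → ℝ) → Fin (d + 1) → ℝ}
    (hν : 0 < ν) (hest : Measurable est) (hunit : ∀ x, est x ⬝ᵥ est x = 1)
    {ξ : Fin (d + 1) → ℝ} (hξ : ξ ⬝ᵥ ξ = 1) :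
    ∑ i : Fin d, ∫ x, samplePairDensity ν ξ ξ x * (est x 0 * est x i.succ - ξ 0 * ξ i.succ) ^ 2 ≤
      ∫ x, (1 - (est x ⬝ᵥ ξ) ^ 2)
        ∂(Measure.pi fun _ : κ => mvGaussian (d + 1) (ν • Matrix.vecMulVec ξ ξ + 1)) := by
  have hcoord : ∀ i, Measurable fun x => est x i := fun i => (measurable_pi_apply i).comp hest
  have hint := integrable_samplePairDensity (κ := κ) hν hξ hξ
  have hterm : ∀ i : Fin d, Integrable fun x => samplePairDensity ν ξ ξ x *
      (est x 0 * est x i.succ - ξ 0 * ξ i.succ) ^ 2 := fun i =>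
    integrable_mul_sub_sq hint ((hcoord 0).mul (hcoord i.succ))
      (fun x => abs_mul_le_one_of_dotProduct_self (hunit x) _ _) _
  rw [pi_mvGaussian_spiked hν hξ, integral_withDensity_ofReal
    (measurable_samplePairDensity ν ξ ξ) (samplePairDensity_nonneg ν ξ ξ),
    ← integral_finsetSum _ fun i _ => hterm i]
  refine integral_mono (integrable_finsetSum _ fun i _ => hterm i) ?_ fun x => ?_
  · refine hint.mul_bdd (c := 1) ?_ (Filter.Eventually.of_forall fun x => ?_)
    · have : Measurable fun x => est x ⬝ᵥ ξ :=
        Finset.measurable_fun_sum _ fun i _ => (hcoord i).mul_const _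
      exact (measurable_const.sub (this.pow_const 2)).aestronglyMeasurable
    · have := dotProduct_sq_le (est x) ξ
      rw [hunit, hξ, one_mul] at this
      rw [Real.norm_eq_abs, abs_of_nonneg (sub_nonneg.2 this)]
      exact sub_le_self _ (sq_nonneg _)
  · simp only [← Finset.mul_sum]
    exact mul_le_mul_of_nonneg_left (sum_offDiag_sq_le (hunit x) hξ)
      (samplePairDensity_nonneg ν ξ ξ x)

/-- The minimax risk is bounded below through the hypercube of spikes `(c, ± s, …, ± s)`. -/
theorem hypercube_lower_bound [Nonempty κ] {d : ℕ}
    {est : (κ → Fin (d + 1) → ℝ) → Fin (d + 1) → ℝ}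
    (hν : 0 < ν) (hest : Measurable est) (hunit : ∀ x, est x ⬝ᵥ est x = 1) {c s : ℝ}
    (hcs : c ^ 2 + d * s ^ 2 = 1) (hs : Fintype.card κ * (ν ^ 2 * s ^ 2 / (1 + ν)) ≤ 1 / 2) :
    d * (c ^ 2 * s ^ 2) / 4 ≤ ⨆ ξ : {v : Fin (d + 1) → ℝ // vecNorm v = 1},
      ∫ x, (1 - (est x ⬝ᵥ ξ.1) ^ 2)
        ∂(Measure.pi fun _ : κ => mvGaussian (d + 1) (ν • Matrix.vecMulVec ξ.1 ξ.1 + 1)) := by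
  have hcube := cubeSpike_dotProduct_self hcs
  have key := assouad_average (d := d) (b := c ^ 2 * s ^ 2 / 2)
    (R := ⨆ ξ : {v : Fin (d + 1) → ℝ // vecNorm v = 1}, ∫ x, (1 - (est x ⬝ᵥ ξ.1) ^ 2)
        ∂(Measure.pi fun _ : κ => mvGaussian (d + 1) (ν • Matrix.vecMulVec ξ.1 ξ.1 + 1)))
    (H := fun i ω => ∫ x, samplePairDensity ν (cubeSpike c s ω) (cubeSpike c s ω) x *
      (est x 0 * est x i.succ - cubeSpike c s ω 0 * cubeSpike c s ω i.succ) ^ 2)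
    (fun i ω => ?_) fun ω => ?_
  · linarith
  · have hsep : Fintype.card κ * (ν ^ 2 *
        (1 - (cubeSpike c s ω ⬝ᵥ cubeSpike c s (flipSign i ω)) ^ 2) / (4 * (1 + ν))) ≤ 1 / 2 := by
      refine le_trans (mul_le_mul_of_nonneg_left ?_ (Nat.cast_nonneg _)) hs
      rw [cubeSpike_dotProduct_flipSign hcs, div_le_div_iff₀ (by positivity) (by positivity)]
      have : 0 ≤ ν ^ 2 * (1 + ν) * (s ^ 2) ^ 2 := by positivity
      nlinarith
    have haff := three_quarters_le_integral_samplePairDensity (κ := κ) hν (hcube ω)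
      (hcube (flipSign i ω)) hsep
    have htwo := two_point_lower_bound
      (samplePairDensity_nonneg (κ := κ) ν (cubeSpike c s ω) (cubeSpike c s ω))
      (samplePairDensity_nonneg ν (cubeSpike c s (flipSign i ω)) (cubeSpike c s (flipSign i ω)))
      (samplePairDensity_sq ν (cubeSpike c s ω) (cubeSpike c s (flipSign i ω)))
      (integrable_samplePairDensity hν (hcube _) (hcube _))
      (integrable_samplePairDensity hν (hcube _) (hcube _))
      (integrable_samplePairDensity hν (hcube _) (hcube _))
      (integral_samplePairDensity_self hν (hcube _))
      (integral_samplePairDensity_self hν (hcube _))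
      (((measurable_pi_apply 0).comp hest).mul ((measurable_pi_apply i.succ).comp hest))
      (fun x => abs_mul_le_one_of_dotProduct_self (hunit x) 0 i.succ)
      (cubeSpike c s ω 0 * cubeSpike c s ω i.succ)
    have hneg : cubeSpike c s (flipSign i ω) 0 * cubeSpike c s (flipSign i ω) i.succ =
        -(cubeSpike c s ω 0 * cubeSpike c s ω i.succ) := by
      rw [cubeSpike_flipSign, mul_neg]
      rfl
    have hsq : (cubeSpike c s ω 0 * cubeSpike c s ω i.succ) ^ 2 = c ^ 2 * s ^ 2 := by
      rw [mul_pow, cubeSpike_succ_sq]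
      rfl
    rw [hsq] at htwo
    simp only [hneg]
    refine le_trans ?_ htwo
    nlinarith [mul_nonneg (sq_nonneg c) (sq_nonneg s)]
  · exact (sum_integral_offDiag_le_risk hν hest hunit (hcube ω)).trans
      (le_ciSup (bddAbove_risk hν hunit)
        (⟨cubeSpike c s ω, (vecNorm_eq_one_iff _).2 (hcube ω)⟩ :
          {v : Fin (d + 1) → ℝ // vecNorm v = 1}))

end Risk

/-- Proposition 3.7 (minimax lower bound for the spiked eigenvector in the
single-spike model): there is a universal constant `c > 0` such that for every
measurable estimator with unit-vector values, the supremum over unit spikes `ξ` of the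
expected loss `1 − (ξ̂ᵀξ)²` under `n` i.i.d. samples from `N_p(0, ν ξ ξᵀ + I_p)` is at
least `c · min{((1+ν)/ν²)(p/n), 1}`. -/
theorem statement4 :
    ∃ c : ℝ, 0 < c ∧
      ∀ (p n : ℕ), 2 ≤ p → 1 ≤ n → ∀ ν : ℝ, 0 < ν →
        ∀ est : (Fin n → Fin p → ℝ) → Fin p → ℝ,
          Measurable est → (∀ x, vecNorm (est x) = 1) →
          c * min ((1 + ν) / ν ^ 2 * ((p : ℝ) / n)) 1 ≤
            ⨆ ξ : {v : Fin p → ℝ // vecNorm v = 1},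
              ∫ x, (1 - (est x ⬝ᵥ ξ.1) ^ 2)
                ∂(Measure.pi fun _ : Fin n =>
                    mvGaussian p (ν • Matrix.vecMulVec ξ.1 ξ.1 + 1)) := by
  refine ⟨1 / 32, by norm_num, fun p n hp hn ν hν est hest hnorm => ?_⟩
  obtain ⟨d, rfl⟩ : ∃ d, p = d + 1 := ⟨p - 1, by omega⟩
  have hd : (1 : ℝ) ≤ d := by exact_mod_cast (by omega : 1 ≤ d)
  have hn' : (1 : ℝ) ≤ n := by exact_mod_cast hn
  have : Nonempty (Fin n) := ⟨⟨0, hn⟩⟩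
  have hq : 0 < (1 + ν) / ν ^ 2 / n := by positivity
  set q := (1 + ν) / ν ^ 2 / n with hqdef
  set m := min (1 / d : ℝ) q with hm
  have hm0 : 0 < m := lt_min (by positivity) hq
  have hs2 : Real.sqrt (m / 2) ^ 2 = m / 2 := Real.sq_sqrt (by positivity)
  have hdm : d * m ≤ 1 := by
    calc d * m ≤ d * (1 / d : ℝ) := by gcongr; exact min_le_left _ _
      _ = 1 := by field_simp
  have hc2 : Real.sqrt (1 - d * (m / 2)) ^ 2 = 1 - d * (m / 2) := Real.sq_sqrt (by linarith)
  refine le_trans ?_ (hypercube_lower_bound (c := Real.sqrt (1 - d * (m / 2)))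
    (s := Real.sqrt (m / 2)) hν hest (fun x => (vecNorm_eq_one_iff _).1 (hnorm x)) ?_ ?_)
  · rw [hs2, hc2]
    have hrate : min ((1 + ν) / ν ^ 2 * (((d + 1 : ℕ) : ℝ) / n)) 1 ≤ 2 * (d * m) := by
      have hcast : (1 + ν) / ν ^ 2 * (((d + 1 : ℕ) : ℝ) / n) = (d + 1) * q := by
        rw [hqdef]; push_cast; ring
      rw [hcast, hm]
      rcases min_choice (1 / d : ℝ) q with h | h <;> rw [h]
      · refine (min_le_right _ _).trans ?_
        rw [mul_one_div_cancel (by positivity)]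
        norm_num
      · refine (min_le_left _ _).trans ?_
        nlinarith
    nlinarith [mul_nonneg (by positivity : (0 : ℝ) ≤ d * m) (sub_nonneg.2 hdm)]
  · rw [hs2, hc2]; ring
  · rw [hs2, Fintype.card_fin]
    calc (n : ℝ) * (ν ^ 2 * (m / 2) / (1 + ν)) ≤ n * (ν ^ 2 * (q / 2) / (1 + ν)) := by
          gcongr; exact min_le_right _ _
      _ = 1 / 2 := by rw [hqdef]; field_simp
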